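/- Let A and B be finite sets and R ⊆ A × B. Suppose {A_i}_{i∈I} is a partition of A and {B_j}_{j∈J} is a partition of B which is equitable for R, and let R⁺ = ⋃{A_i × B_j : (A_i × B_j) ∩ R ≠ ∅}. Then the bipartite graph ⟨A, B, R⟩ has a complete matching if and only if ⟨A, B, R⁺⟩ has a complete matching. -/

import Mathlib

open Finset in
/-- A fractional matching saturating `A` yields a complete matching. -/
theorem exists_injective_of_fractional_matching {A B : Type*} [Fintype A] [Fintype B]
    (R : A → B → Prop) (w : A → B → ℚ) (hw : ∀ a b, 0 ≤ w a b) (hR : ∀ a b, ¬ R a b → w a b = 0)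
    (hrow : ∀ a, 1 ≤ ∑ b, w a b) (hcol : ∀ b, ∑ a, w a b ≤ 1) :
    ∃ M : A → B, Function.Injective M ∧ ∀ a, R a (M a) := by
  classical
  rw [← Fintype.all_card_le_filter_rel_iff_exists_injective]
  intro S
  have key : (#S : ℚ) ≤ #{b | ∃ a ∈ S, R a b} := by
    calc (#S : ℚ) = ∑ a ∈ S, 1 := by simp
      _ ≤ ∑ a ∈ S, ∑ b, w a b := sum_le_sum fun a _ => hrow a
      _ = ∑ a ∈ S, ∑ b with ∃ a ∈ S, R a b, w a b := by
        refine sum_congr rfl fun a ha => (sum_filter_of_ne fun b _ hb => ?_).symm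
        exact ⟨a, ha, not_imp_comm.1 (hR a b) hb⟩
      _ = ∑ b with ∃ a ∈ S, R a b, ∑ a ∈ S, w a b := sum_comm
      _ ≤ ∑ b with ∃ a ∈ S, R a b, 1 := by
        refine sum_le_sum fun b _ => le_trans ?_ (hcol b)
        exact sum_le_sum_of_subset_of_nonneg (subset_univ S) fun a _ _ => hw a b
      _ = _ := by simp
  exact_mod_cast key

open Finset in
/-- The edges between two blocks of an equitable pair, counted from either block. -/
theorem card_edges_eq_card_mul_degree {A B I J : Type*} [Fintype A] [Fintype B]
    [DecidableEq I] [DecidableEq J] (R : A → B → Prop) [∀ a b, Decidable (R a b)]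
    (pA : A → I) (pB : B → J)
    (h : ∀ a a' : A, pA a = pA a' → ∀ j : J,
      #{b | pB b = j ∧ R a b} = #{b | pB b = j ∧ R a' b}) (a : A) (j : J) :
    ∑ x with pA x = pA a, #{b | pB b = j ∧ R x b} =
      #{x | pA x = pA a} * #{b | pB b = j ∧ R a b} := by
  rw [sum_const_nat fun x hx => h x a (by simpa using hx) j]

open Finset in
/-- With equitable partitions `pA`, `pB` for `R` and `R⁺` defined by joining blocks
completely whenever they contain an `R`-edge, the bipartite graph `⟨A, B, R⟩` has a
complete matching iff `⟨A, B, R⁺⟩` has one. -/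
theorem stmt1 {A B I J : Type} [Fintype A] [Fintype B]
    (R : A → B → Prop) (pA : A → I) (pB : B → J)
    (heqA : ∀ a a' : A, pA a = pA a' → ∀ j : J,
      Nat.card {b : B // pB b = j ∧ R a b} = Nat.card {b : B // pB b = j ∧ R a' b})
    (heqB : ∀ b b' : B, pB b = pB b' → ∀ i : I,
      Nat.card {a : A // pA a = i ∧ R a b} = Nat.card {a : A // pA a = i ∧ R a b'})
    (Rplus : A → B → Prop)
    (hRplus : ∀ a b, Rplus a b ↔ ∃ a' b', pA a' = pA a ∧ pB b' = pB b ∧ R a' b') :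
    (∃ M : A → B, Function.Injective M ∧ ∀ a, R a (M a)) ↔
    (∃ M : A → B, Function.Injective M ∧ ∀ a, Rplus a (M a)) := by
  classical
  refine ⟨fun ⟨M, hM, h⟩ => ⟨M, hM, fun a => (hRplus _ _).2 ⟨a, M a, rfl, rfl, h a⟩⟩, ?_⟩
  rintro ⟨M, hM, hMR⟩
  simp only [Nat.card_eq_fintype_card, Fintype.card_subtype] at heqA heqB
  let e : I → J → ℕ := fun i j => ∑ x with pA x = i, #{b | pB b = j ∧ R x b}
  have heA : ∀ a j, e (pA a) j = #{x | pA x = pA a} * #{b | pB b = j ∧ R a b} :=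
    card_edges_eq_card_mul_degree R pA pB heqA
  have heB : ∀ i b, e i (pB b) = #{y | pB y = pB b} * #{a | pA a = i ∧ R a b} := by
    intro i b
    rw [← card_edges_eq_card_mul_degree (fun b a => R a b) pB pA heqB]
    have h := sum_card_bipartiteAbove_eq_sum_card_bipartiteBelow (s := {x | pA x = i}) (t := {y | pB y = pB b}) R
    simpa only [e, bipartiteAbove, bipartiteBelow, filter_filter] using h
  have hpos : ∀ a, e (pA a) (pB (M a)) ≠ 0 := by
    intro a
    obtain ⟨a', b', ha, hb, h⟩ := (hRplus _ _).1 (hMR a)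
    have h1 : a' ∈ ({x | pA x = pA a'} : Finset A) := by simp
    have h2 : b' ∈ ({b | pB b = pB (M a) ∧ R a' b} : Finset B) := by simp [hb, h]
    rw [← ha, heA]
    exact mul_ne_zero (card_ne_zero_of_mem h1) (card_ne_zero_of_mem h2)
  clear_value e
  let w : A → B → ℚ := fun a b => ∑ x : A,
    if pA a = pA x ∧ pB b = pB (M x) ∧ R a b then (e (pA x) (pB (M x)) : ℚ)⁻¹ else 0
  refine exists_injective_of_fractional_matching R w ?_ ?_ ?_ ?_
  · intro a b
    exact sum_nonneg fun x _ => ite_nonneg (inv_nonneg.2 (Nat.cast_nonneg _)) le_rfl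
  · intro a b h
    simp [w, h]
  · intro a
    have hrow : ∀ x, (∑ b, if pA a = pA x ∧ pB b = pB (M x) ∧ R a b then
        (e (pA x) (pB (M x)) : ℚ)⁻¹ else 0) =
        if pA x = pA a then (#{x | pA x = pA a} : ℚ)⁻¹ else 0 := by
      intro x
      by_cases hx : pA x = pA a
      · have h := hpos x
        rw [hx, heA] at h
        simp only [hx, true_and, if_true]
        rw [← sum_filter, sum_const, nsmul_eq_mul, heA, Nat.cast_mul]
        have h1 := (Nat.cast_ne_zero (R := ℚ)).2 (left_ne_zero_of_mul h)
        have h2 := (Nat.cast_ne_zero (R := ℚ)).2 (right_ne_zero_of_mul h)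
        field_simp
      · simp [hx, Ne.symm hx]
    rw [sum_comm, sum_congr rfl fun x _ => hrow x, ← sum_filter, sum_const, nsmul_eq_mul]
    have ha : a ∈ ({x | pA x = pA a} : Finset A) := by simp
    exact (mul_inv_cancel₀ (Nat.cast_ne_zero.2 (card_ne_zero_of_mem ha))).ge
  · intro b
    have hcol : ∀ x, (∑ a, if pA a = pA x ∧ pB b = pB (M x) ∧ R a b then
        (e (pA x) (pB (M x)) : ℚ)⁻¹ else 0) =
        if pB (M x) = pB b then (#{y | pB y = pB b} : ℚ)⁻¹ else 0 := by
      intro x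
      by_cases hx : pB (M x) = pB b
      · have h := hpos x
        rw [hx, heB] at h
        simp only [hx, true_and, if_true]
        rw [← sum_filter, sum_const, nsmul_eq_mul, heB, Nat.cast_mul]
        have h1 := (Nat.cast_ne_zero (R := ℚ)).2 (left_ne_zero_of_mul h)
        have h2 := (Nat.cast_ne_zero (R := ℚ)).2 (right_ne_zero_of_mul h)
        field_simp
      · simp [hx, Ne.symm hx]
    rw [sum_comm, sum_congr rfl fun x _ => hcol x, ← sum_filter, sum_const, nsmul_eq_mul,
      ← div_eq_mul_inv]
    refine div_le_one_of_le₀ (Nat.cast_le.2 ?_) (Nat.cast_nonneg _)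
    exact card_le_card_of_injOn M (fun x hx => by simpa using hx) hM.injOn
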